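/- Assume k ≥ 6 is an even integer, f is modular of weight k for Γ_0(N), a(1) = 1, and the Deligne bound |a(n)| ≤ d(n)·n^{(k−1)/2} holds for all n ≥ 1. Then there is a constant C depending only on k such that for every γ = (a b; c d) ∈ SL₂(ℤ) with N | c and c > 0, writing r_{f,γ}(X) = Σ_{i=0}^{k−2} b_i X^i, one has b_{k−2} ≠ 0 and, for each 0 ≤ i ≤ k−2, |b_i/b_{k−2} − (−1)^i·binom(k−2, i)·(a/c)^{k−2−i}| ≤ C·(1+|a/c|)^{k−3−i}·c^{−2}. -/

import Mathlib

open Complex MeasureTheory Real Filter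

noncomputable section

lemma hasSum_card_divisors_div_rpow {σ : ℝ} (hσ : 1 < σ) :
    HasSum (fun n : ℕ => (n.divisors.card : ℝ) / (n : ℝ) ^ σ)
      ((∑' n : ℕ, 1 / (n : ℝ) ^ σ) ^ 2) := by
  have hZ : HasSum (fun n : ℕ => 1 / (n : ℝ) ^ σ) (∑' n : ℕ, 1 / (n : ℝ) ^ σ) :=
    (Real.summable_one_div_nat_rpow.mpr hσ).hasSum
  have hterm (g : ℕ → ℝ) (n : ℕ) : LSeries.term (fun m => (g m : ℂ)) (σ : ℂ) n
      = ((g n / (n : ℝ) ^ σ : ℝ) : ℂ) := by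
    rcases eq_or_ne n 0 with rfl | hn
    · simp [Real.zero_rpow (by linarith : σ ≠ 0)]
    · rw [LSeries.term_of_ne_zero hn]
      push_cast
      rw [Complex.ofReal_cpow (Nat.cast_nonneg n)]
      simp
  have h1 : LSeriesHasSum (fun _ => ((1 : ℝ) : ℂ)) σ ((∑' n : ℕ, 1 / (n : ℝ) ^ σ : ℝ) : ℂ) := by
    unfold LSeriesHasSum
    rw [funext (hterm fun _ => 1), Complex.hasSum_ofReal]
    exact hZ
  have h2 := h1.convolution h1
  have hconv : LSeries.convolution (fun _ => ((1 : ℝ) : ℂ)) (fun _ => ((1 : ℝ) : ℂ))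
      = fun n => (((n.divisors.card : ℕ) : ℝ) : ℂ) := by
    rw [LSeries.convolution_def]
    funext n
    simp [← Nat.map_div_right_divisors]
  rw [hconv] at h2
  unfold LSeriesHasSum at h2
  rw [funext (hterm fun n => (n.divisors.card : ℝ)), ← Complex.ofReal_mul,
    Complex.hasSum_ofReal, ← pow_two] at h2
  exact h2

lemma tsum_one_div_rpow_five_halves_sq_lt :
    (∑' n : ℕ, 1 / (n : ℝ) ^ (5 / 2 : ℝ)) ^ 2 < 2 := by
  have hs : Summable (fun n : ℕ => 1 / (n : ℝ) ^ (5 / 2 : ℝ)) :=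
    Real.summable_one_div_nat_rpow.mpr (by norm_num)
  have h2 := hasSum_zeta_two
  have e1 := hs.sum_add_tsum_nat_add 4
  have e2 := h2.summable.sum_add_tsum_nat_add 4
  rw [h2.tsum_eq] at e2
  have hpow (x : ℝ) (hx : 0 < x) : x ^ (5 / 2 : ℝ) = x ^ 2 * √x := by
    rw [Real.sqrt_eq_rpow, ← Real.rpow_natCast, ← Real.rpow_add hx]
    norm_num
  have hle : ∑' n : ℕ, 1 / ((n + 4 : ℕ) : ℝ) ^ (5 / 2 : ℝ)
      ≤ ∑' n : ℕ, (1 / 2) * (1 / ((n + 4 : ℕ) : ℝ) ^ 2) := by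
    refine Summable.tsum_le_tsum (fun n => ?_) ((summable_nat_add_iff 4).mpr hs)
      (((summable_nat_add_iff 4).mpr h2.summable).mul_left _)
    have hn : (4 : ℝ) ≤ ((n + 4 : ℕ) : ℝ) := by push_cast; linarith [n.cast_nonneg (α := ℝ)]
    rw [hpow _ (by linarith), one_div_mul_one_div]
    have : 2 ≤ √((n + 4 : ℕ) : ℝ) := Real.le_sqrt_of_sq_le (by linarith)
    apply one_div_le_one_div_of_le (by positivity)
    nlinarith [sq_nonneg ((n + 4 : ℕ) : ℝ)]
  rw [tsum_mul_left] at hle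
  have b2 : (1 : ℝ) / 2 ^ (5 / 2 : ℝ) ≤ 0.1769 := by
    rw [hpow 2 (by norm_num), div_le_iff₀ (by positivity)]
    have : 1.414 ≤ √2 := Real.le_sqrt_of_sq_le (by norm_num)
    linarith
  have b3 : (1 : ℝ) / 3 ^ (5 / 2 : ℝ) ≤ 0.0643 := by
    rw [hpow 3 (by norm_num), div_le_iff₀ (by positivity)]
    have : 1.73 ≤ √3 := Real.le_sqrt_of_sq_le (by norm_num)
    linarith
  have hpi : π ^ 2 < 3.15 ^ 2 := by
    have := Real.pi_lt_d2
    have := Real.pi_pos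
    gcongr
  simp only [Finset.sum_range_succ, Finset.sum_range_zero] at e1 e2
  norm_num at e1 e2 hle b2 b3 hpi
  have h0 : 0 ≤ ∑' n : ℕ, 1 / (n : ℝ) ^ (5 / 2 : ℝ) := tsum_nonneg fun n => by positivity
  norm_num at h0 ⊢
  have : ∑' n : ℕ, ((n : ℝ) ^ (5 / 2 : ℝ))⁻¹ ≤ 1.41 := by linarith
  nlinarith

lemma integrableOn_and_integral_inv_substitution {E : Type*} [NormedAddCommGroup E]
    [NormedSpace ℝ E] (g : ℝ → E) {c : ℝ} (hc : 0 < c) :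
    (IntegrableOn (fun u => (c * u ^ 2)⁻¹ • g (c * u)⁻¹) (Set.Ioi 0) ↔
      IntegrableOn g (Set.Ioi 0)) ∧
    ∫ u in Set.Ioi (0 : ℝ), (c * u ^ 2)⁻¹ • g (c * u)⁻¹ = ∫ t in Set.Ioi (0 : ℝ), g t := by
  have hcongr : Set.EqOn (fun u : ℝ => (|(-1 : ℝ)| * u ^ ((-1 : ℝ) - 1)) •
      ((fun y => c⁻¹ • g (c⁻¹ * y)) (u ^ (-1 : ℝ))))
      (fun u => (c * u ^ 2)⁻¹ • g (c * u)⁻¹) (Set.Ioi 0) := by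
    intro u hu
    have hu : 0 < u := hu
    have e : u ^ ((-1 : ℝ) - 1) = (u ^ 2)⁻¹ := by
      rw [show (-1 : ℝ) - 1 = -((2 : ℕ) : ℝ) by norm_num, Real.rpow_neg hu.le, Real.rpow_natCast]
    simp only [e, Real.rpow_neg_one, abs_neg, abs_one, one_mul, smul_smul, mul_inv]
    rw [mul_comm]
  constructor
  · rw [← integrableOn_congr_fun hcongr measurableSet_Ioi,
      integrableOn_Ioi_comp_rpow_iff (fun y => c⁻¹ • g (c⁻¹ * y)) (p := -1) (by norm_num)]
    have := integrableOn_Ioi_comp_mul_left_iff g 0 (inv_pos.mpr hc)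
    rw [mul_zero] at this
    rw [← this]
    exact integrable_smul_iff (inv_ne_zero hc.ne') _
  · rw [← setIntegral_congr_fun measurableSet_Ioi hcongr,
      integral_comp_rpow_Ioi (fun y => c⁻¹ • g (c⁻¹ * y)) (p := -1) (by norm_num),
      integral_smul, integral_comp_mul_left_Ioi _ _ (inv_pos.mpr hc), mul_zero, smul_smul]
    simp [hc.ne']

lemma summable_mul_exp_of_summable_div_pow {c : ℕ → ℂ} {m : ℕ}
    (hc : Summable fun n : ℕ => ‖c n‖ / ((n : ℝ) + 1) ^ (m + 1)) {t : ℝ} (ht : 0 < t) :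
    Summable fun n : ℕ => ‖c n‖ * rexp (-(2 * π * ((n : ℝ) + 1)) * t) := by
  refine Summable.of_nonneg_of_le (fun n => by positivity) (fun n => ?_)
    (hc.mul_left ((m + 1).factorial / (2 * π * t) ^ (m + 1)))
  have hn : (0 : ℝ) < (n : ℝ) + 1 := by positivity
  have hy : 0 < 2 * π * t * ((n : ℝ) + 1) := by have := Real.pi_pos; positivity
  have := Real.pow_div_factorial_le_exp (2 * π * t * ((n : ℝ) + 1)) hy.le (m + 1)
  rw [show -(2 * π * ((n : ℝ) + 1)) * t = -(2 * π * t * ((n : ℝ) + 1)) by ring, Real.exp_neg]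
  have h2 : (rexp (2 * π * t * ((n : ℝ) + 1)))⁻¹
      ≤ ((2 * π * t * ((n : ℝ) + 1)) ^ (m + 1) / (m + 1).factorial)⁻¹ :=
    inv_anti₀ (by positivity) this
  calc _ ≤ ‖c n‖ * ((2 * π * t * ((n : ℝ) + 1)) ^ (m + 1) / (m + 1).factorial)⁻¹ := by gcongr
    _ = _ := by rw [mul_pow _ ((n : ℝ) + 1), inv_div]; field_simp

lemma hasSum_integral_exp_series_mul_pow {c : ℕ → ℂ} {m : ℕ} {F : ℝ → ℂ}
    (hc : Summable fun n : ℕ => ‖c n‖ / ((n : ℝ) + 1) ^ (m + 1))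
    (hF : ∀ t, 0 < t → F t = ∑' n : ℕ, c n * (rexp (-(2 * π * ((n : ℝ) + 1)) * t) : ℂ)) :
    HasSum (fun n : ℕ => ((m.factorial / (2 * π) ^ (m + 1) : ℝ) : ℂ) *
      (c n / ((n : ℂ) + 1) ^ (m + 1))) (∫ t in Set.Ioi (0 : ℝ), F t * (t : ℂ) ^ m) := by
  have h2pi : (0 : ℝ) < 2 * π := by have := Real.pi_pos; positivity
  have hre : ((m : ℂ) + 1).re = ((m + 1 : ℕ) : ℝ) := by simp
  have h := hasSum_mellin (a := c) (p := fun n : ℕ => 2 * π * ((n : ℝ) + 1)) (F := F)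
    (s := (m : ℂ) + 1) (fun n => Or.inr (by positivity)) (by rw [hre]; positivity)
    (fun t ht => ?_) ?_
  · convert! h using 1
    · funext n
      rw [Complex.Gamma_nat_eq_factorial]
      have : ((m : ℂ) + 1) = ((m + 1 : ℕ) : ℂ) := by push_cast; ring
      rw [this, Complex.cpow_natCast]
      push_cast
      rw [mul_pow (2 * (π : ℂ))]
      have : (n : ℂ) + 1 ≠ 0 := by exact_mod_cast Nat.succ_ne_zero n
      have : (π : ℂ) ≠ 0 := by exact_mod_cast Real.pi_ne_zero
      field_simp
    · unfold mellin
      refine setIntegral_congr_fun measurableSet_Ioi fun t ht => ?_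
      simp [mul_comm]
  · rw [hF t ht]
    refine (Summable.of_norm ?_).hasSum
    refine (summable_mul_exp_of_summable_div_pow hc ht).congr fun n => ?_
    rw [norm_mul, Complex.norm_real, Real.norm_eq_abs, Real.abs_exp]
  · rw [hre]
    refine (hc.mul_left ((2 * π) ^ (m + 1))⁻¹).congr fun n => ?_
    rw [Real.rpow_natCast, mul_pow (2 * π)]
    field_simp

lemma integrableOn_exp_series_mul_pow {c : ℕ → ℂ} {m : ℕ} {F : ℝ → ℂ} (h0 : c 0 ≠ 0)
    (hc : Summable fun n : ℕ => ‖c n‖ / ((n : ℝ) + 1) ^ (m + 1))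
    (hF : ∀ t, 0 < t → F t = ∑' n : ℕ, c n * (rexp (-(2 * π * ((n : ℝ) + 1)) * t) : ℂ)) :
    IntegrableOn (fun t => F t * (t : ℂ) ^ m) (Set.Ioi 0) ∧
    ∫ t in Set.Ioi (0 : ℝ), ‖F t‖ * t ^ m ≤
      m.factorial / (2 * π) ^ (m + 1) * ∑' n : ℕ, ‖c n‖ / ((n : ℝ) + 1) ^ (m + 1) := by
  have h2pi : (0 : ℝ) < 2 * π := by have := Real.pi_pos; positivity
  have hsum (t : ℝ) (ht : 0 < t) := summable_mul_exp_of_summable_div_pow hc ht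
  set G : ℝ → ℝ := fun t => ∑' n : ℕ, ‖c n‖ * rexp (-(2 * π * ((n : ℝ) + 1)) * t) with hG
  have hGsum := hasSum_integral_exp_series_mul_pow (c := fun n => (‖c n‖ : ℂ)) (m := m)
    (F := fun t => (G t : ℂ)) (by simpa using hc) (fun t _ => by rw [hG]; push_cast; rfl)
  have hGsum' : HasSum (fun n : ℕ => m.factorial / (2 * π) ^ (m + 1) *
      (‖c n‖ / ((n : ℝ) + 1) ^ (m + 1))) (∫ t in Set.Ioi (0 : ℝ), G t * t ^ m) := by
    rw [← Complex.hasSum_ofReal, ← integral_complex_ofReal]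
    convert! hGsum using 2 <;> push_cast <;> rfl
  have hGint : IntegrableOn (fun t => G t * t ^ m) (Set.Ioi 0) := by
    refine Integrable.of_integral_ne_zero (ne_of_gt ?_)
    rw [← hGsum'.tsum_eq]
    refine hGsum'.summable.tsum_pos (fun n => by positivity) 0 ?_
    have := norm_pos_iff.mpr h0
    positivity
  have hle (t : ℝ) (ht : 0 < t) : ‖F t‖ ≤ G t := by
    rw [hF t ht]
    refine (norm_tsum_le_tsum_norm ?_).trans_eq ?_
    · refine (hsum t ht).congr fun n => ?_
      rw [norm_mul, Complex.norm_real, Real.norm_eq_abs, Real.abs_exp]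
    · refine tsum_congr fun n => ?_
      rw [norm_mul, Complex.norm_real, Real.norm_eq_abs, Real.abs_exp]
  have hmeas : AEStronglyMeasurable F (volume.restrict (Set.Ioi 0)) := by
    refine aestronglyMeasurable_of_tendsto_ae atTop (f := fun (N : ℕ) (t : ℝ) =>
      ∑ n ∈ Finset.range N, c n * (rexp (-(2 * π * ((n : ℝ) + 1)) * t) : ℂ))
      (fun N => Continuous.aestronglyMeasurable (by fun_prop)) ?_
    filter_upwards [ae_restrict_mem measurableSet_Ioi] with t ht
    rw [hF t ht]
    refine (Summable.of_norm ((hsum t ht).congr fun n => ?_)).hasSum.tendsto_sum_nat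
    rw [norm_mul, Complex.norm_real, Real.norm_eq_abs, Real.abs_exp]
  have hint : IntegrableOn (fun t => F t * (t : ℂ) ^ m) (Set.Ioi 0) := by
    refine Integrable.mono' hGint
      (hmeas.mul (Continuous.aestronglyMeasurable (by fun_prop))) ?_
    filter_upwards [ae_restrict_mem measurableSet_Ioi] with t ht
    have ht : 0 < t := ht
    rw [norm_mul, norm_pow, Complex.norm_real, Real.norm_of_nonneg ht.le]
    gcongr
    exact hle t ht
  refine ⟨hint, ?_⟩
  rw [← tsum_mul_left, hGsum'.tsum_eq]
  refine setIntegral_mono_on ?_ hGint measurableSet_Ioi fun t ht => ?_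
  · refine IntegrableOn.congr_fun hint.norm (fun t ht => ?_) measurableSet_Ioi
    have ht : 0 < t := ht
    rw [norm_mul, norm_pow, Complex.norm_real, Real.norm_of_nonneg ht.le]
  · have ht : 0 < t := ht
    gcongr
    exact hle t ht

lemma norm_div_pow_le_card_divisors_div_rpow {a : ℕ → ℂ} {k m : ℕ} {σ : ℝ}
    (ha : ∀ n : ℕ, 1 ≤ n → ‖a n‖ ≤ (n.divisors.card : ℝ) * (n : ℝ) ^ (((k : ℝ) - 1) / 2))
    (hσ : σ + ((k : ℝ) - 1) / 2 ≤ m + 1) (n : ℕ) :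
    ‖a (n + 1)‖ / ((n : ℝ) + 1) ^ (m + 1)
      ≤ ((n + 1).divisors.card : ℝ) / ((n + 1 : ℕ) : ℝ) ^ σ := by
  have hn : (0 : ℝ) < (n : ℝ) + 1 := by positivity
  have h := ha (n + 1) (by omega)
  push_cast at h ⊢
  rw [div_le_div_iff₀ (by positivity) (by positivity)]
  calc _ ≤ ((n + 1).divisors.card : ℝ) * ((n : ℝ) + 1) ^ (((k : ℝ) - 1) / 2) * ((n : ℝ) + 1) ^ σ := by
        gcongr
    _ = ((n + 1).divisors.card : ℝ) * ((n : ℝ) + 1) ^ (σ + ((k : ℝ) - 1) / 2) := by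
        rw [mul_assoc, ← Real.rpow_add hn, add_comm σ]
    _ ≤ ((n + 1).divisors.card : ℝ) * ((n : ℝ) + 1) ^ ((m + 1 : ℕ) : ℝ) := by
        gcongr
        · linarith [n.cast_nonneg (α := ℝ)]
        · push_cast; exact hσ
    _ = _ := by rw [Real.rpow_natCast]

lemma fourier_series_on_vertical_line {a : ℕ → ℂ} {f : ℂ → ℂ}
    (hf : ∀ z : ℂ, f z =
      ∑' n : ℕ, a (n + 1) * Complex.exp (2 * (π : ℂ) * I * ((n : ℂ) + 1) * z)) (x t : ℝ) :
    f (x + I * t) = ∑' n : ℕ, (a (n + 1) * Complex.exp ((2 * π * ((n : ℝ) + 1) * x : ℝ) * I)) *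
      (rexp (-(2 * π * ((n : ℝ) + 1)) * t) : ℂ) := by
  rw [hf]
  refine tsum_congr fun n => ?_
  rw [mul_assoc (a (n + 1)), Complex.ofReal_exp, ← Complex.exp_add]
  congr 2
  push_cast
  linear_combination (2 * π * ((n : ℂ) + 1) * t) * I_mul_I

lemma integrableOn_vertical_line_mul_pow {a : ℕ → ℂ} {f : ℂ → ℂ} {k m : ℕ}
    (hf : ∀ z : ℂ, f z =
      ∑' n : ℕ, a (n + 1) * Complex.exp (2 * (π : ℂ) * I * ((n : ℂ) + 1) * z))
    (h1 : a 1 = 1)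
    (ha : ∀ n : ℕ, 1 ≤ n → ‖a n‖ ≤ (n.divisors.card : ℝ) * (n : ℝ) ^ (((k : ℝ) - 1) / 2))
    (hm : k ≤ 2 * m) (x : ℝ) :
    IntegrableOn (fun t : ℝ => f (x + I * t) * (t : ℂ) ^ m) (Set.Ioi 0) ∧
    ∫ t in Set.Ioi (0 : ℝ), ‖f (x + I * t)‖ * t ^ m ≤ m.factorial / (2 * π) ^ (m + 1) *
      ∑' n : ℕ, ((n + 1).divisors.card : ℝ) / ((n + 1 : ℕ) : ℝ) ^ (3 / 2 : ℝ) := by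
  have hpi := Real.pi_pos
  have hS := (summable_nat_add_iff 1).mpr
    (hasSum_card_divisors_div_rpow (σ := 3 / 2) (by norm_num)).summable
  have hm' : (k : ℝ) ≤ 2 * m := by exact_mod_cast hm
  have hle := norm_div_pow_le_card_divisors_div_rpow (m := m) (σ := 3 / 2) ha (by linarith)
  have hc : Summable fun n : ℕ => ‖a (n + 1) * Complex.exp ((2 * π * ((n : ℝ) + 1) * x : ℝ) * I)‖ /
      ((n : ℝ) + 1) ^ (m + 1) := by
    simp_rw [norm_mul, Complex.norm_exp_ofReal_mul_I, mul_one]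
    exact Summable.of_nonneg_of_le (fun n => by positivity) hle hS
  obtain ⟨hI, hB⟩ := integrableOn_exp_series_mul_pow (F := fun t : ℝ => f (x + I * t))
    (by simp [h1]) hc (fun t _ => fourier_series_on_vertical_line hf x t)
  refine ⟨hI, hB.trans (mul_le_mul_of_nonneg_left ?_ (by positivity))⟩
  refine Summable.tsum_le_tsum (fun n => ?_) hc hS
  rw [norm_mul, Complex.norm_exp_ofReal_mul_I, mul_one]
  exact hle n

lemma le_norm_integral_vertical_line_mul_pow {a : ℕ → ℂ} {f : ℂ → ℂ} {k m : ℕ}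
    (hf : ∀ z : ℂ, f z =
      ∑' n : ℕ, a (n + 1) * Complex.exp (2 * (π : ℂ) * I * ((n : ℂ) + 1) * z))
    (h1 : a 1 = 1)
    (ha : ∀ n : ℕ, 1 ≤ n → ‖a n‖ ≤ (n.divisors.card : ℝ) * (n : ℝ) ^ (((k : ℝ) - 1) / 2))
    (hm : k + 2 ≤ 2 * m) (x : ℝ) :
    m.factorial / (2 * π) ^ (m + 1) * (2 - (∑' n : ℕ, 1 / (n : ℝ) ^ (5 / 2 : ℝ)) ^ 2) ≤
      ‖∫ t in Set.Ioi (0 : ℝ), f (x + I * t) * (t : ℂ) ^ m‖ := by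
  have hpi := Real.pi_pos
  have hd := hasSum_card_divisors_div_rpow (σ := 5 / 2) (by norm_num)
  have hS := (summable_nat_add_iff 1).mpr hd.summable
  have hSeq := hd.summable.sum_add_tsum_nat_add 2
  rw [hd.tsum_eq] at hSeq
  simp [Finset.sum_range_succ] at hSeq
  have hm' : (k : ℝ) + 2 ≤ 2 * m := by exact_mod_cast hm
  have hle := norm_div_pow_le_card_divisors_div_rpow (m := m) (σ := 5 / 2) ha (by linarith)
  set c : ℕ → ℂ := fun n => a (n + 1) * Complex.exp ((2 * π * ((n : ℝ) + 1) * x : ℝ) * I) with hcdef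
  have hcn (n : ℕ) : ‖c n‖ = ‖a (n + 1)‖ := by
    simp only [hcdef, norm_mul, Complex.norm_exp_ofReal_mul_I, mul_one]
  simp_rw [← hcn] at hle
  have hc : Summable fun n : ℕ => ‖c n‖ / ((n : ℝ) + 1) ^ (m + 1) :=
    Summable.of_nonneg_of_le (fun n => by positivity) hle hS
  have h := hasSum_integral_exp_series_mul_pow (F := fun t : ℝ => f (x + I * t)) hc
    (fun t _ => fourier_series_on_vertical_line hf x t)
  rw [← h.tsum_eq, tsum_mul_left, norm_mul, Complex.norm_real,
    Real.norm_of_nonneg (by positivity)]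
  gcongr
  have hnorm (n : ℕ) : ‖c n / ((n : ℂ) + 1) ^ (m + 1)‖ = ‖c n‖ / ((n : ℝ) + 1) ^ (m + 1) := by
    rw [norm_div, norm_pow]
    congr 2
    exact_mod_cast Complex.norm_natCast (n + 1)
  have hcs : Summable fun n : ℕ => c n / ((n : ℂ) + 1) ^ (m + 1) :=
    Summable.of_norm (hc.congr fun n => (hnorm n).symm)
  have hc0 : ‖c 0‖ = 1 := by rw [hcn]; simp [h1]
  rw [hcs.tsum_eq_zero_add]
  have htail : ‖∑' n : ℕ, c (n + 1) / (((n + 1 : ℕ) : ℂ) + 1) ^ (m + 1)‖ ≤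
      ∑' n : ℕ, ((n + 2).divisors.card : ℝ) / ((n + 2 : ℕ) : ℝ) ^ (5 / 2 : ℝ) := by
    refine tsum_of_norm_bounded ((summable_nat_add_iff 2).mpr hd.summable).hasSum fun n => ?_
    rw [hnorm]
    exact hle (n + 1)
  push_cast at htail
  have := norm_sub_le_norm_add (c 0) (∑' n : ℕ, c (n + 1) / (((n : ℂ) + 1) + 1) ^ (m + 1))
  simp only [Nat.cast_zero, zero_add, one_pow, div_one, Nat.cast_add, Nat.cast_one,
    one_div]
  linarith

lemma norm_pow_sub_pow_le {x y : ℂ} {R : ℝ} (hx : ‖x‖ ≤ R) (hy : ‖y‖ ≤ R) (n : ℕ) :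
    ‖x ^ (n + 1) - y ^ (n + 1)‖ ≤ (n + 1) * ‖x - y‖ * R ^ n := by
  have hR : 0 ≤ R := (norm_nonneg x).trans hx
  induction n with
  | zero => simp
  | succ n ih =>
    calc ‖x ^ (n + 1 + 1) - y ^ (n + 1 + 1)‖
        = ‖x * (x ^ (n + 1) - y ^ (n + 1)) + (x - y) * y ^ (n + 1)‖ := by ring_nf
      _ ≤ ‖x‖ * ‖x ^ (n + 1) - y ^ (n + 1)‖ + ‖x - y‖ * ‖y‖ ^ (n + 1) := by
        rw [← norm_mul, ← norm_pow, ← norm_mul]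
        exact norm_add_le _ _
      _ ≤ R * ((n + 1) * ‖x - y‖ * R ^ n) + ‖x - y‖ * R ^ (n + 1) := by gcongr
      _ = _ := by push_cast; ring

lemma norm_add_I_mul_pow_sub_pow_le {n l : ℕ} (hn : n + 1 ≤ l) (x : ℝ) {t : ℝ} (ht : 0 < t) :
    ‖((x : ℂ) + I * t) ^ (n + 1) - (x : ℂ) ^ (n + 1)‖ ≤
      l * 2 ^ l * (1 + |x|) ^ n * (t + t ^ l) := by
  have hx0 := abs_nonneg x
  have hx : ‖(x : ℂ)‖ ≤ (1 + |x|) * (1 + t) := by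
    rw [Complex.norm_real, Real.norm_eq_abs]; nlinarith
  have hxt : ‖(x : ℂ) + I * t‖ ≤ (1 + |x|) * (1 + t) := by
    refine (norm_add_le _ _).trans ?_
    rw [norm_mul, Complex.norm_I, Complex.norm_real, Complex.norm_real, Real.norm_eq_abs,
      Real.norm_of_nonneg ht.le]
    nlinarith
  have h := norm_pow_sub_pow_le hxt hx n
  rw [add_sub_cancel_left, norm_mul, Complex.norm_I, Complex.norm_real,
    Real.norm_of_nonneg ht.le, one_mul, mul_pow] at h
  have hpoly : t * (1 + t) ^ n ≤ 2 ^ l * (t + t ^ l) := by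
    have h2 : (2 : ℝ) ^ n ≤ 2 ^ l := pow_le_pow_right₀ (by norm_num) (by omega)
    have htl : 0 ≤ t ^ l := by positivity
    rcases le_total t 1 with h1 | h1
    · calc t * (1 + t) ^ n ≤ t * 2 ^ n := by gcongr; linarith
        _ ≤ t * 2 ^ l := by gcongr
        _ ≤ _ := by rw [mul_comm]; gcongr; linarith
    · calc t * (1 + t) ^ n ≤ t * (2 * t) ^ n := by gcongr; linarith
        _ = 2 ^ n * t ^ (n + 1) := by ring
        _ ≤ 2 ^ l * t ^ l := by gcongr
        _ ≤ _ := by gcongr; linarith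
  have hl : (n : ℝ) + 1 ≤ l := by exact_mod_cast hn
  calc _ ≤ ((n : ℝ) + 1) * t * ((1 + |x|) ^ n * (1 + t) ^ n) := h
    _ = ((n : ℝ) + 1) * (1 + |x|) ^ n * (t * (1 + t) ^ n) := by ring
    _ ≤ l * (1 + |x|) ^ n * (2 ^ l * (t + t ^ l)) := by gcongr
    _ = _ := by ring

lemma integral_mul_pow_of_inversion {F G : ℝ → ℂ} {C : ℝ} (hC : 0 < C) {k m l e : ℕ}
    (hl : m + l + 2 = k) (he : e + 2 * m + 2 = k)
    (hFG : ∀ u, 0 < u → F (C ^ 2 * u)⁻¹ = (I * (C * u)) ^ k * G u) :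
    (IntegrableOn (fun u : ℝ => G u * (u : ℂ) ^ l) (Set.Ioi 0) →
      IntegrableOn (fun t : ℝ => F t * (t : ℂ) ^ m) (Set.Ioi 0)) ∧
    ‖∫ t in Set.Ioi (0 : ℝ), F t * (t : ℂ) ^ m‖
      = C ^ e * ‖∫ u in Set.Ioi (0 : ℝ), G u * (u : ℂ) ^ l‖ ∧
    ∫ t in Set.Ioi (0 : ℝ), ‖F t‖ * t ^ m = C ^ e * ∫ u in Set.Ioi (0 : ℝ), ‖G u‖ * u ^ l := by
  have hC2 : 0 < C ^ 2 := by positivity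
  obtain ⟨hI, hE⟩ := integrableOn_and_integral_inv_substitution
    (fun t : ℝ => F t * (t : ℂ) ^ m) hC2
  obtain ⟨-, hN⟩ := integrableOn_and_integral_inv_substitution (fun t : ℝ => ‖F t‖ * t ^ m) hC2
  have hpow (u : ℝ) (hu : 0 < u) :
      (C ^ 2 * u ^ 2)⁻¹ * ((C * u) ^ k * ((C ^ 2 * u)⁻¹) ^ m) = C ^ e * u ^ l := by
    have h1 : (C * u) ^ k = C ^ e * u ^ l * (C ^ 2 * u) ^ m * (C ^ 2 * u ^ 2) := by
      rw [mul_pow C u k]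
      nth_rewrite 1 [← he]
      rw [← hl]
      ring
    rw [h1, inv_pow]
    field_simp
  have hcongr : Set.EqOn (fun u : ℝ => (C ^ 2 * u ^ 2)⁻¹ •
      (F (C ^ 2 * u)⁻¹ * (((C ^ 2 * u)⁻¹ : ℝ) : ℂ) ^ m))
      (fun u => (I ^ k * (C : ℂ) ^ e) * (G u * (u : ℂ) ^ l)) (Set.Ioi 0) := by
    intro u hu
    have hp := congrArg (fun r : ℝ => (r : ℂ)) (hpow u hu)
    simp only [Complex.real_smul]
    rw [hFG u hu, mul_pow I]
    push_cast at hp ⊢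
    linear_combination (I ^ k * G u) * hp
  have hcongrN : Set.EqOn (fun u : ℝ => (C ^ 2 * u ^ 2)⁻¹ •
      (‖F (C ^ 2 * u)⁻¹‖ * ((C ^ 2 * u)⁻¹) ^ m))
      (fun u => C ^ e * (‖G u‖ * u ^ l)) (Set.Ioi 0) := by
    intro u hu
    have hu' : 0 < u := hu
    simp only [smul_eq_mul]
    rw [hFG u hu, norm_mul, norm_pow, norm_mul, Complex.norm_I, one_mul, ← Complex.ofReal_mul,
      Complex.norm_real, Real.norm_of_nonneg (by positivity)]
    linear_combination ‖G u‖ * hpow u hu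
  refine ⟨fun h => hI.mp ((integrableOn_congr_fun hcongr measurableSet_Ioi).mpr (h.const_mul _)),
    ?_, ?_⟩
  · rw [← hE, setIntegral_congr_fun measurableSet_Ioi hcongr, integral_const_mul, norm_mul,
      norm_mul, norm_pow, norm_pow, Complex.norm_I, Complex.norm_real,
      Real.norm_of_nonneg hC.le, one_pow, one_mul]
  · rw [← hN, setIntegral_congr_fun measurableSet_Ioi hcongrN, integral_const_mul]

lemma apply_vertical_line_inversion {f : ℂ → ℂ} {k : ℕ} {A B C D : ℤ} (hdet : A * D - B * C = 1)
    (hC : 0 < C)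
    (hmod : ∀ z : ℂ, 0 < z.im → f (((A : ℂ) * z + (B : ℂ)) / ((C : ℂ) * z + (D : ℂ)))
      = ((C : ℂ) * z + (D : ℂ)) ^ k * f z) {u : ℝ} (hu : 0 < u) :
    f ((((A : ℝ) / (C : ℝ) : ℝ) : ℂ) + I * (((((C : ℝ) ^ 2 * u)⁻¹ : ℝ)) : ℂ)) =
      (I * (((C : ℝ) : ℂ) * u)) ^ k * f (((-(D : ℝ) / (C : ℝ) : ℝ) : ℂ) + I * u) := by
  have hC0 : (C : ℂ) ≠ 0 := by exact_mod_cast hC.ne'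
  have hu0 : (u : ℂ) ≠ 0 := by exact_mod_cast hu.ne'
  have hdet' : (A : ℂ) * D - B * C = 1 := by exact_mod_cast hdet
  have h := hmod (((-(D : ℝ) / (C : ℝ) : ℝ) : ℂ) + I * u) (by simpa using hu)
  have hden : (C : ℂ) * (((-(D : ℝ) / (C : ℝ) : ℝ) : ℂ) + I * u) + D
      = I * (((C : ℝ) : ℂ) * u) := by
    push_cast; field_simp; ring
  rw [hden] at h
  rw [← h]
  congr 1
  push_cast
  have hI : I * ((C : ℂ) * u) ≠ 0 := by simp [hC0, hu0]
  rw [eq_div_iff hI]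
  field_simp
  linear_combination (1 : ℂ) * I_sq + hdet'

lemma norm_integral_mul_add_pow_sub_le {F : ℝ → ℂ} {l n : ℕ} (hn : n + 1 ≤ l) (x : ℝ)
    (h0 : IntegrableOn F (Set.Ioi 0))
    (h1 : IntegrableOn (fun t : ℝ => F t * (t : ℂ)) (Set.Ioi 0))
    (h2 : IntegrableOn (fun t : ℝ => F t * (t : ℂ) ^ l) (Set.Ioi 0)) :
    ‖(∫ t in Set.Ioi (0 : ℝ), F t * ((x : ℂ) + I * t) ^ (n + 1)) -
        (x : ℂ) ^ (n + 1) * ∫ t in Set.Ioi (0 : ℝ), F t‖ ≤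
      l * 2 ^ l * (1 + |x|) ^ n *
        ((∫ t in Set.Ioi (0 : ℝ), ‖F t‖ * t) + ∫ t in Set.Ioi (0 : ℝ), ‖F t‖ * t ^ l) := by
  have h1' : IntegrableOn (fun t : ℝ => ‖F t‖ * t) (Set.Ioi 0) :=
    IntegrableOn.congr_fun h1.norm (fun t (ht : 0 < t) => by
      rw [norm_mul, Complex.norm_real, Real.norm_of_nonneg ht.le]) measurableSet_Ioi
  have h2' : IntegrableOn (fun t : ℝ => ‖F t‖ * t ^ l) (Set.Ioi 0) :=
    IntegrableOn.congr_fun h2.norm (fun t (ht : 0 < t) => by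
      rw [norm_mul, norm_pow, Complex.norm_real, Real.norm_of_nonneg ht.le]) measurableSet_Ioi
  set H : ℝ → ℝ := fun t => l * 2 ^ l * (1 + |x|) ^ n * (‖F t‖ * t + ‖F t‖ * t ^ l) with hH
  have hHint : IntegrableOn H (Set.Ioi 0) := (h1'.add h2').const_mul _
  have hle : ∀ᵐ t ∂(volume.restrict (Set.Ioi (0 : ℝ))),
      ‖F t * (((x : ℂ) + I * t) ^ (n + 1) - (x : ℂ) ^ (n + 1))‖ ≤ H t := by
    filter_upwards [ae_restrict_mem measurableSet_Ioi] with t ht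
    rw [norm_mul]
    calc _ ≤ ‖F t‖ * (l * 2 ^ l * (1 + |x|) ^ n * (t + t ^ l)) := by
          gcongr; exact norm_add_I_mul_pow_sub_pow_le hn x ht
      _ = H t := by rw [hH]; ring
  have hdiff : IntegrableOn
      (fun t : ℝ => F t * (((x : ℂ) + I * t) ^ (n + 1) - (x : ℂ) ^ (n + 1))) (Set.Ioi 0) :=
    Integrable.mono' hHint (h0.aestronglyMeasurable.mul
      (Continuous.aestronglyMeasurable (by fun_prop))) hle
  have hsplit : (∫ t in Set.Ioi (0 : ℝ), F t * ((x : ℂ) + I * t) ^ (n + 1)) -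
      (x : ℂ) ^ (n + 1) * ∫ t in Set.Ioi (0 : ℝ), F t =
      ∫ t in Set.Ioi (0 : ℝ), F t * (((x : ℂ) + I * t) ^ (n + 1) - (x : ℂ) ^ (n + 1)) := by
    rw [sub_eq_iff_eq_add, ← integral_const_mul, ← integral_add hdiff (h0.const_mul _)]
    congr 1
    funext t
    ring
  rw [hsplit, ← integral_add h1' h2', ← integral_const_mul]
  exact norm_integral_le_of_norm_le hHint hle

/-- For even `k ≥ 6` there is a constant `K` depending only on `k` such that:
whenever `f` is modular of weight `k` for `Γ₀(N)` with `a(1) = 1` and Deligne bound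
`|a(n)| ≤ d(n) n^{(k-1)/2}`, and `γ = (a b; c d) ∈ SL₂(ℤ)` with `N ∣ c`, `c > 0`, the period
polynomial `r_{f,γ}(X) = Σ_i b_i X^i` has `b_{k-2} ≠ 0` and, for each `0 ≤ i ≤ k-2`,
`|b_i/b_{k-2} − (−1)^i binom(k−2, i) (a/c)^{k−2−i}| ≤ K (1+|a/c|)^{k−3−i} c^{−2}`
(the exponent `k−3−i` taken as an integer). -/
theorem normalized_coefficients_of_period_polynomials
    (k : ℕ) (hk : 6 ≤ k) (hke : Even k) :
    ∃ K : ℝ, ∀ N : ℕ, 1 ≤ N → ∀ a : ℕ → ℂ, ∀ f : ℂ → ℂ,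
      (∀ z : ℂ, f z = ∑' n : ℕ, a (n + 1) * Complex.exp (2 * (π : ℂ) * I * ((n : ℂ) + 1) * z)) →
      (∀ A B C D : ℤ, A * D - B * C = 1 → (N : ℤ) ∣ C → ∀ z : ℂ, 0 < z.im →
        f (((A : ℂ) * z + (B : ℂ)) / ((C : ℂ) * z + (D : ℂ)))
          = ((C : ℂ) * z + (D : ℂ)) ^ k * f z) →
      a 1 = 1 →
      (∀ n : ℕ, 1 ≤ n → ‖a n‖ ≤ (n.divisors.card : ℝ) * (n : ℝ) ^ (((k : ℝ) - 1) / 2)) →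
      ∀ A B C D : ℤ, A * D - B * C = 1 → (N : ℤ) ∣ C → 0 < C →
      ∀ b : ℕ → ℂ,
        (∀ i : ℕ, b i = ((k - 1).factorial : ℂ)⁻¹ * (-1 : ℂ) ^ i * ((k - 2).choose i : ℂ) *
          (I * ∫ t in Set.Ioi (0 : ℝ),
            f ((((A : ℝ) / (C : ℝ) : ℝ) : ℂ) + I * (t : ℂ)) *
              ((((A : ℝ) / (C : ℝ) : ℝ) : ℂ) + I * (t : ℂ)) ^ (k - 2 - i))) →
        b (k - 2) ≠ 0 ∧
        ∀ i : ℕ, i ≤ k - 2 →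
          ‖b i / b (k - 2) -
              (-1 : ℂ) ^ i * ((k - 2).choose i : ℂ) * ((((A : ℝ) / (C : ℝ) : ℝ) : ℂ)) ^ (k - 2 - i)‖
            ≤ K * (1 + |(A : ℝ) / (C : ℝ)|) ^ ((k : ℤ) - 3 - (i : ℤ)) * ((C : ℝ)) ^ (-2 : ℤ) := by
  have hpi := Real.pi_pos
  set S : ℝ := ∑' n : ℕ, ((n + 1).divisors.card : ℝ) / ((n + 1 : ℕ) : ℝ) ^ (3 / 2 : ℝ)
  have hS0 : 0 ≤ S := tsum_nonneg fun n => by positivity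
  set W : ℕ → ℝ := fun m => m.factorial / (2 * π) ^ (m + 1) with hW
  have hW0 (m : ℕ) : 0 < W m := by simp only [hW]; positivity
  set β : ℝ := W (k - 2) * (2 - (∑' n : ℕ, 1 / (n : ℝ) ^ (5 / 2 : ℝ)) ^ 2)
  have hβ : 0 < β :=
    mul_pos (hW0 _) (by linarith [tsum_one_div_rpow_five_halves_sq_lt])
  set M : ℝ := W (k - 3) * S + W (k - 2) * S with hMdef
  have hM0 : 0 ≤ M := by have := hW0 (k - 3); have := hW0 (k - 2); positivity
  set L : ℝ := (k - 2 : ℕ) * 2 ^ (k - 2)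
  have hL0 : 0 ≤ L := by positivity
  refine ⟨2 ^ (k - 2) * (L * (M / β)), ?_⟩
  intro N _ a f hf hmod h1 ha A B C D hdet hNC hC b hb
  set x : ℝ := (A : ℝ) / (C : ℝ)
  have hCr : (1 : ℝ) ≤ (C : ℝ) := by exact_mod_cast hC
  have hC0 : (0 : ℝ) < C := by linarith
  set F : ℝ → ℂ := fun t => f ((x : ℂ) + I * t) with hF
  set G : ℝ → ℂ := fun u => f (((-(D : ℝ) / (C : ℝ) : ℝ) : ℂ) + I * u) with hG
  have hFG (u : ℝ) (hu : 0 < u) : F ((C : ℝ) ^ 2 * u)⁻¹ = (I * (((C : ℝ) : ℂ) * u)) ^ k * G u :=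
    apply_vertical_line_inversion hdet hC (hmod A B C D hdet hNC) hu
  obtain ⟨hG3, hG3'⟩ := integrableOn_vertical_line_mul_pow (m := k - 3) hf h1 ha (by omega)
    (-(D : ℝ) / (C : ℝ))
  have hG2 := le_norm_integral_vertical_line_mul_pow (m := k - 2) hf h1 ha (by omega)
    (-(D : ℝ) / (C : ℝ))
  obtain ⟨hF2, hF2'⟩ := integrableOn_vertical_line_mul_pow (m := k - 2) hf h1 ha (by omega) x
  obtain ⟨-, hE0, -⟩ := integral_mul_pow_of_inversion (m := 0) (l := k - 2) (e := k - 2) hC0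
    (by omega) (by omega) hFG
  obtain ⟨hI1, -, hE1⟩ := integral_mul_pow_of_inversion (m := 1) (l := k - 3) (e := k - 4) hC0
    (by omega) (by omega) hFG
  simp only [pow_one, pow_zero, mul_one] at hE0 hI1 hE1
  have hF1 := hI1 hG3
  set J : ℂ := ∫ t in Set.Ioi (0 : ℝ), F t with hJ
  have hJle : (C : ℝ) ^ (k - 2) * β ≤ ‖J‖ := by
    rw [hE0]
    exact mul_le_mul_of_nonneg_left hG2 (by positivity)
  have hJpos : 0 < ‖J‖ := lt_of_lt_of_le (by positivity) hJle
  have hJ0 : J ≠ 0 := norm_pos_iff.mp hJpos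
  have hF0 : IntegrableOn F (Set.Ioi 0) := Integrable.of_integral_ne_zero hJ0
  have hmom : (∫ t in Set.Ioi (0 : ℝ), ‖F t‖ * t) + (∫ t in Set.Ioi (0 : ℝ), ‖F t‖ * t ^ (k - 2))
      ≤ (C : ℝ) ^ (k - 4) * M := by
    have e1 : ∫ t in Set.Ioi (0 : ℝ), ‖F t‖ * t ≤ (C : ℝ) ^ (k - 4) * (W (k - 3) * S) := by
      rw [hE1]
      exact mul_le_mul_of_nonneg_left hG3' (by positivity)
    have e2 : W (k - 2) * S ≤ (C : ℝ) ^ (k - 4) * (W (k - 2) * S) :=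
      le_mul_of_one_le_left (mul_nonneg (hW0 _).le hS0) (one_le_pow₀ hCr)
    rw [hMdef, mul_add]
    exact add_le_add e1 (hF2'.trans e2)
  have hfac : ((k - 1).factorial : ℂ) ≠ 0 := Nat.cast_ne_zero.mpr (Nat.factorial_ne_zero _)
  have hlead : b (k - 2) = ((k - 1).factorial : ℂ)⁻¹ * (I * J) := by
    rw [hb, (Nat.even_sub (by omega)).mpr (by simp [hke]) |>.neg_one_pow]
    simp [hJ, hF]
  refine ⟨by rw [hlead]; simp [hfac, hJ0, I_ne_zero], fun i hi => ?_⟩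
  have hquot : b i / b (k - 2) - (-1 : ℂ) ^ i * ((k - 2).choose i : ℂ) * (x : ℂ) ^ (k - 2 - i) =
      (-1 : ℂ) ^ i * ((k - 2).choose i : ℂ) *
        (((∫ t in Set.Ioi (0 : ℝ), F t * ((x : ℂ) + I * t) ^ (k - 2 - i)) -
          (x : ℂ) ^ (k - 2 - i) * J) / J) := by
    rw [hb, hlead]
    have hI := I_ne_zero
    simp only [hF]
    field_simp
  rw [hquot, norm_mul, norm_mul, norm_pow, norm_neg, norm_one, one_pow, one_mul,
    Complex.norm_natCast, norm_div]
  rcases hi.eq_or_lt with rfl | hlt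
  · simp only [Nat.sub_self, pow_zero, mul_one, one_mul]
    rw [← hJ, sub_self, norm_zero, zero_div, mul_zero]
    positivity
  obtain ⟨n, hn⟩ : ∃ n, k - 2 - i = n + 1 := ⟨k - 2 - i - 1, by omega⟩
  have hzpow : (k : ℤ) - 3 - (i : ℤ) = (n : ℤ) := by omega
  have hdiff := norm_integral_mul_add_pow_sub_le (F := F) (l := k - 2) (n := n) (by omega) x
    hF0 hF1 hF2
  rw [hn, hzpow, zpow_natCast]
  have hchoose : ((k - 2).choose i : ℝ) ≤ 2 ^ (k - 2) := by
    exact_mod_cast Nat.choose_le_two_pow (k - 2) i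
  have hCpow : (C : ℝ) ^ (k - 2) = (C : ℝ) ^ (k - 4) * (C : ℝ) ^ 2 := by
    rw [← pow_add]; congr 1; omega
  calc _ ≤ 2 ^ (k - 2) * ((L * (1 + |x|) ^ n * ((C : ℝ) ^ (k - 4) * M)) /
          ((C : ℝ) ^ (k - 2) * β)) := by
        gcongr
        exact hdiff.trans (mul_le_mul_of_nonneg_left hmom (by positivity))
    _ = _ := by
        rw [hCpow, zpow_neg, zpow_ofNat]
        field_simp
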